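/- Let K₁ and L₁ be finite simplicial complexes of dimension ≤ 1 in ℝ³ and let f : ℝ³ → ℝ³ be a homeomorphism with f(|K₁|) = |L₁|. Then there exists a continuous map g : [0,1] × ℝ³ → ℝ³ such that: (i) each g_t := g(t, ·) is a homeomorphism of ℝ³ with g₀ = f; (ii) g_t(|K₁|) = |L₁| for all t ∈ [0,1]; and (iii) there exist finite simplicial complexes K̃₁ and L̃₁ of dimension ≤ 1 with |K̃₁| = |K₁| and |L̃₁| = |L₁|, in which the convex hull of every face of K̃₁ is contained in the convex hull of some face of K₁ (and similarly for L̃₁ with respect to L₁), such that g₁ maps the convex hull of each face of K̃₁ affinely onto the convex hull of a face of L̃₁. -/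

import Mathlib

open Set

/-- `ℝ³` as `Fin 3 → ℝ`. -/
abbrev E3 : Type := Fin 3 → ℝ

/-- `φ` maps the convex hull of each face of `K` affinely onto the convex hull of a face of `L`. -/
def MapsFacesAffinely (φ : E3 → E3) (K L : Geometry.SimplicialComplex ℝ E3) : Prop :=
  ∀ s ∈ K.faces, ∃ u ∈ L.faces,
    φ '' (convexHull ℝ (s : Set E3)) = convexHull ℝ (u : Set E3) ∧
    ∃ A : E3 →ᵃ[ℝ] E3, Set.EqOn φ A (convexHull ℝ (s : Set E3))

section Segment

variable {E : Type*} [AddCommGroup E] [Module ℝ E] {a b p x : E}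

theorem notMem_segment_of_mem_segment (hp : p ∈ segment ℝ a b) (hpb : p ≠ b) :
    b ∉ segment ℝ a p := fun hb =>
  hpb ((wbtw_swap_right_iff ℝ a).1
    ⟨mem_segment_iff_wbtw.1 hp, mem_segment_iff_wbtw.1 hb⟩)

theorem eq_of_mem_segment_of_mem_segment (hp : p ∈ segment ℝ a b) (hxa : x ∈ segment ℝ a p)
    (hxb : x ∈ segment ℝ b p) : x = p := by
  rw [mem_segment_iff_wbtw] at hp hxa hxb
  exact (wbtw_swap_right_iff ℝ b).1 ⟨hxb, (hp.trans_left_right hxa).symm⟩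

theorem segment_union_segment_of_mem (hp : p ∈ segment ℝ a b) :
    segment ℝ a p ∪ segment ℝ b p = segment ℝ a b := by
  refine Subset.antisymm (union_subset ?_ ?_) fun x hx => ?_
  · exact (convex_segment a b).segment_subset (left_mem_segment ℝ a b) hp
  · exact (convex_segment a b).segment_subset (right_mem_segment ℝ a b) hp
  · rw [segment_eq_image'] at hp hx
    obtain ⟨q, ⟨hq0, hq1⟩, rfl⟩ := hp
    obtain ⟨r, ⟨hr0, hr1⟩, rfl⟩ := hx
    rcases le_total r q with h | h
    · left
      rw [segment_eq_image']
      rcases hq0.eq_or_lt with rfl | hq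
      · exact ⟨0, by simp, by simp [le_antisymm h hr0]⟩
      · refine ⟨r / q, ⟨by positivity, (div_le_one hq).2 h⟩, ?_⟩
        simp only [add_sub_cancel_left, smul_smul]
        rw [div_mul_cancel₀ _ hq.ne']
    · right
      rw [segment_eq_image']
      rcases hq1.eq_or_lt with rfl | hq
      · exact ⟨0, by simp, by simp [le_antisymm hr1 h]⟩
      · have hq' : 0 < 1 - q := by linarith
        refine ⟨(1 - r) / (1 - q), ⟨div_nonneg (by linarith) hq'.le,
          (div_le_one hq').2 (by linarith)⟩, ?_⟩
        have : a + q • (b - a) - b = -((1 - q) • (b - a)) := by module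
        simp only [this, smul_neg, smul_smul]
        rw [div_mul_cancel₀ _ hq'.ne']
        module

end Segment

namespace Geometry.SimplicialComplex

section Module

variable {E : Type*} [AddCommGroup E] [Module ℝ E] {K : SimplicialComplex ℝ E}
  {s t : Finset E} {x p : E}

/-- A finite simplicial complex of dimension at most one. -/
structure IsFiniteGraph (K : SimplicialComplex ℝ E) : Prop where
  finite : K.faces.Finite
  card_le_two : ∀ s ∈ K.faces, s.card ≤ 2

/-- `K'` has the same underlying space as `K` and each face of `K'` lies in a face of `K`. -/
structure IsSubdivisionOf (K' K : SimplicialComplex ℝ E) : Prop where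
  space_eq : K'.space = K.space
  exists_subset : ∀ s ∈ K'.faces, ∃ u ∈ K.faces,
    convexHull ℝ (s : Set E) ⊆ convexHull ℝ (u : Set E)

theorem IsSubdivisionOf.refl (K : SimplicialComplex ℝ E) : K.IsSubdivisionOf K :=
  ⟨rfl, fun s hs => ⟨s, hs, Subset.rfl⟩⟩

theorem IsSubdivisionOf.trans {K₁ K₂ K₃ : SimplicialComplex ℝ E} (h₁ : K₁.IsSubdivisionOf K₂)
    (h₂ : K₂.IsSubdivisionOf K₃) : K₁.IsSubdivisionOf K₃ := by
  refine ⟨h₁.space_eq.trans h₂.space_eq, fun s hs => ?_⟩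
  obtain ⟨u, hu, hsu⟩ := h₁.exists_subset s hs
  obtain ⟨v, hv, huv⟩ := h₂.exists_subset u hu
  exact ⟨v, hv, hsu.trans huv⟩

namespace IsFiniteGraph

/-- Distinct faces of a graph meet only in common vertices. -/
theorem mem_of_ne (hK : K.IsFiniteGraph) (hs : s ∈ K.faces) (ht : t ∈ K.faces) (hst : s ≠ t)
    (hxs : x ∈ convexHull ℝ (s : Set E)) (hxt : x ∈ convexHull ℝ (t : Set E)) :
    x ∈ s ∧ x ∈ t := by
  classical
  have hx := K.inter_subset_convexHull hs ht ⟨hxs, hxt⟩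
  rw [← Finset.coe_inter] at hx
  have hcard : (s ∩ t).card ≤ 1 := by
    by_contra! h
    have h1 := Finset.eq_of_subset_of_card_le (Finset.inter_subset_left (s₁ := s) (s₂ := t))
      ((hK.card_le_two s hs).trans h)
    have h2 := Finset.eq_of_subset_of_card_le (Finset.inter_subset_right (s₁ := s) (s₂ := t))
      ((hK.card_le_two t ht).trans h)
    exact hst (h1.symm.trans h2)
  obtain ⟨v, hv⟩ := Finset.card_le_one_iff_subset_singleton (α := E) (s := s ∩ t) |>.1 hcard
  have hne : (s ∩ t).Nonempty := by
    rw [← Finset.coe_nonempty]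
    exact convexHull_nonempty_iff.1 ⟨x, hx⟩
  rw [Finset.Nonempty.subset_singleton_iff hne] at hv
  have hxv : x = v := by simpa [hv] using hx
  have := Finset.mem_singleton_self v
  rw [← hv, ← hxv, Finset.mem_inter] at this
  exact this

theorem eq_of_notMem_vertices (hK : K.IsFiniteGraph) (hs : s ∈ K.faces) (ht : t ∈ K.faces)
    (hxs : x ∈ convexHull ℝ (s : Set E)) (hxt : x ∈ convexHull ℝ (t : Set E))
    (hx : x ∉ K.vertices) : s = t := by
  by_contra hst
  exact hx (K.down_closed hs (Finset.singleton_subset_iff.2 (hK.mem_of_ne hs ht hst hxs hxt).1)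
    (Finset.singleton_nonempty x))

theorem vertices_finite (hK : K.IsFiniteGraph) : K.vertices.Finite := by
  rw [vertices_eq]
  exact hK.finite.biUnion fun s _ => s.finite_toSet

theorem eq_singleton_or_eq_pair (hK : K.IsFiniteGraph) (hs : s ∈ K.faces) :
    (∃ a ∈ K.vertices, s = {a}) ∨ ∃ a b, a ≠ b ∧ a ∈ K.vertices ∧ b ∈ K.vertices ∧
      (s : Set E) = {a, b} ∧ convexHull ℝ (s : Set E) = segment ℝ a b ∧
      convexHull ℝ (s : Set E) \ K.vertices = openSegment ℝ a b := by
  classical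
  have hpos := (nonempty_of_mem_faces hs).card_pos
  have hle := hK.card_le_two s hs
  obtain h | h : s.card = 1 ∨ s.card = 2 := by omega
  · obtain ⟨a, rfl⟩ := Finset.card_eq_one.1 h
    exact Or.inl ⟨a, hs, rfl⟩
  · obtain ⟨a, b, hab, rfl⟩ := Finset.card_eq_two.1 h
    have ha : a ∈ K.vertices := K.down_closed hs (by simp) (Finset.singleton_nonempty a)
    have hb : b ∈ K.vertices := K.down_closed hs (by simp) (Finset.singleton_nonempty b)
    have hseg : convexHull ℝ ((({a, b} : Finset E)) : Set E) = segment ℝ a b := by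
      simp [convexHull_pair]
    refine Or.inr ⟨a, b, hab, ha, hb, by simp, hseg, ?_⟩
    ext x
    constructor
    · rintro ⟨hx, hxv⟩
      rw [hseg] at hx
      exact mem_openSegment_of_ne_left_right (by rintro rfl; exact hxv ha)
        (by rintro rfl; exact hxv hb) hx
    · intro hx
      refine ⟨hseg ▸ openSegment_subset_segment ℝ a b hx, fun hxv => ?_⟩
      have hx' := (vertex_mem_convexHull_iff hxv hs).1
        (hseg ▸ openSegment_subset_segment ℝ a b hx)
      rcases Finset.mem_insert.1 hx' with rfl | hx'
      · exact hab ((left_mem_openSegment_iff).1 hx)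
      · rw [Finset.mem_singleton] at hx'
        subst hx'
        exact hab ((right_mem_openSegment_iff).1 hx)

/-- A graph can be subdivided so as to have a prescribed point of its space as a vertex. -/
theorem exists_subdivision_insert (hK : K.IsFiniteGraph) (hp : p ∈ K.space) :
    ∃ K' : SimplicialComplex ℝ E, K'.IsFiniteGraph ∧ K'.IsSubdivisionOf K ∧
      K'.vertices = insert p K.vertices := by
  classical
  by_cases hpv : p ∈ K.vertices
  · exact ⟨K, hK, .refl K, (insert_eq_of_mem hpv).symm⟩
  obtain ⟨e, he, hpe⟩ := mem_space_iff.1 hp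
  obtain ⟨a, ha, rfl⟩ | ⟨a, b, hab, ha, hb, heab, hseg, -⟩ := hK.eq_singleton_or_eq_pair he
  · simp only [Finset.coe_singleton, convexHull_singleton, mem_singleton_iff] at hpe
    exact absurd (hpe ▸ ha) hpv
  have hpa : p ≠ a := by rintro rfl; exact hpv ha
  have hpb : p ≠ b := by rintro rfl; exact hpv hb
  have hpab : p ∈ segment ℝ a b := hseg ▸ hpe
  have hpba : p ∈ segment ℝ b a := segment_symm ℝ a b ▸ hpab
  have hmem : ∀ {x}, x ∈ e ↔ x = a ∨ x = b := fun {x} => by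
    rw [← Finset.mem_coe, heab]; rfl
  have hsub : ∀ t ∈ ({{p}, {a, p}, {b, p}} : Set (Finset E)),
      convexHull ℝ (t : Set E) ⊆ convexHull ℝ (e : Set E) := by
    rw [hseg, ← segment_union_segment_of_mem hpab]
    rintro t (rfl | rfl | rfl)
    · simpa using Or.inl (right_mem_segment ℝ a p)
    · simp [convexHull_pair]
    · simp [convexHull_pair]
  have hold : ∀ s ∈ K.faces, s ≠ e → ∀ t ∈ ({{p}, {a, p}, {b, p}} : Set (Finset E)), ∀ x,
      x ∈ convexHull ℝ (s : Set E) → x ∈ convexHull ℝ (t : Set E) → x ∈ s ∧ x ∈ t := by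
    intro s hs hse t ht x hxs hxt
    obtain ⟨h1, h2⟩ := hK.mem_of_ne hs he hse hxs (hsub t ht hxt)
    refine ⟨h1, ?_⟩
    have h3 := notMem_segment_of_mem_segment hpab hpb
    have h4 := notMem_segment_of_mem_segment hpba hpa
    rcases ht with rfl | rfl | rfl
    · simpa using hxt
    · rcases hmem.1 h2 with rfl | rfl
      · simp
      · exact absurd (by simpa [convexHull_pair] using hxt) h3
    · rcases hmem.1 h2 with rfl | rfl
      · exact absurd (by simpa [convexHull_pair] using hxt) h4
      · simp
  have hnew : ∀ s ∈ ({{p}, {a, p}, {b, p}} : Set (Finset E)),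
      ∀ t ∈ ({{p}, {a, p}, {b, p}} : Set (Finset E)), s ≠ t → ∀ x,
      x ∈ convexHull ℝ (s : Set E) → x ∈ convexHull ℝ (t : Set E) → x ∈ s ∧ x ∈ t := by
    rintro s (rfl | rfl | rfl) t (rfl | rfl | rfl) hst x hxs hxt <;>
      simp only [Finset.coe_insert, Finset.coe_singleton, convexHull_pair,
        convexHull_singleton, mem_singleton_iff, ne_eq, not_true_eq_false] at hst hxs hxt <;>
      first
      | (subst hxs; simp)
      | (subst hxt; simp)
      | (rw [eq_of_mem_segment_of_mem_segment hpab hxs hxt]; simp)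
      | (rw [eq_of_mem_segment_of_mem_segment hpba hxs hxt]; simp)
  have hpair : ∀ q : E, AffineIndependent ℝ ((↑) : ({q, p} : Finset E) → E) := by
    intro q
    obtain rfl | hq := eq_or_ne q p
    · rw [Finset.pair_eq_singleton]
      exact affineIndependent_of_subsingleton ℝ _
    · have h := (affineIndependent_of_ne ℝ hq).range
      have hrange : range ![q, p] = (({q, p} : Finset E) : Set E) := by simp [pair_comm]
      rw [hrange] at h
      exact h
  let K' : SimplicialComplex ℝ E :=
    { faces := {s | s ∈ K.faces ∧ s ≠ e} ∪ {{p}, {a, p}, {b, p}}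
      isRelLowerSet_faces := by
        have hcard : 2 ≤ e.card := by
          rw [Finset.coe_eq_pair.1 heab, Finset.card_pair hab]
        rintro s (⟨hs, hse⟩ | hs)
        · refine ⟨nonempty_of_mem_faces hs, fun t hts ht => Or.inl ⟨K.down_closed hs hts ht, ?_⟩⟩
          rintro rfl
          exact hse (Finset.eq_of_subset_of_card_le hts
            ((hK.card_le_two s hs).trans hcard)).symm
        · have hvert : ∀ v ∈ K.vertices, ({v} : Finset E) ≠ e := by
            rintro v - rfl
            simp at hcard
          have hfaces : ∀ q ∈ K.vertices, ∀ t ⊆ ({q, p} : Finset E), t.Nonempty →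
              t = {p} ∨ t = {q, p} ∨ t ∈ K.faces ∧ t ≠ e := by
            intro q hq t htq ht
            have hcases := Set.subset_pair_iff_eq.1
              ((Finset.coe_subset.2 htq).trans_eq (Finset.coe_pair (a := q) (b := p)))
            rw [Finset.coe_eq_empty, Finset.coe_eq_singleton, Finset.coe_eq_singleton,
              Finset.coe_eq_pair] at hcases
            rcases hcases with rfl | rfl | rfl | rfl
            · exact absurd ht Finset.not_nonempty_empty
            · exact Or.inr (Or.inr ⟨hq, hvert q hq⟩)
            · exact Or.inl rfl
            · exact Or.inr (Or.inl rfl)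
          rcases hs with rfl | rfl | rfl
          · refine ⟨by simp, fun t hts ht => Or.inr (Or.inl ?_)⟩
            exact (Finset.Nonempty.subset_singleton_iff ht).1 hts
          · refine ⟨by simp, fun t hts ht => ?_⟩
            rcases hfaces a ha t hts ht with h | h | h
            · exact Or.inr (Or.inl h)
            · exact Or.inr (Or.inr (Or.inl h))
            · exact Or.inl h
          · refine ⟨by simp, fun t hts ht => ?_⟩
            rcases hfaces b hb t hts ht with h | h | h
            · exact Or.inr (Or.inl h)
            · exact Or.inr (Or.inr (Or.inr h))
            · exact Or.inl h
      indep := by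
        rintro s (⟨hs, -⟩ | rfl | rfl | rfl)
        · exact K.indep hs
        · exact affineIndependent_of_subsingleton ℝ _
        · exact hpair a
        · exact hpair b
      inter_subset_convexHull := by
        intro s t hs ht x hx
        obtain rfl | hst := eq_or_ne s t
        · simpa using hx.1
        refine subset_convexHull ℝ _ ?_
        rcases hs with hs | hs <;> rcases ht with ht | ht
        · exact hK.mem_of_ne hs.1 ht.1 hst hx.1 hx.2
        · exact hold s hs.1 hs.2 t ht x hx.1 hx.2
        · exact (hold t ht.1 ht.2 s hs x hx.2 hx.1).symm
        · exact hnew s hs t ht hst x hx.1 hx.2 }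
  refine ⟨K', ⟨(hK.finite.subset fun s hs => hs.1).union (by simp), ?_⟩, ⟨?_, ?_⟩, ?_⟩
  · rintro s (⟨hs, -⟩ | rfl | rfl | rfl)
    · exact hK.card_le_two s hs
    · simp
    · exact Finset.card_le_two
    · exact Finset.card_le_two
  · refine Subset.antisymm ?_ ?_
    · intro x hx
      obtain ⟨s, hs | hs, hxs⟩ := mem_space_iff.1 hx
      · exact mem_space_iff.2 ⟨s, hs.1, hxs⟩
      · exact mem_space_iff.2 ⟨e, he, hsub s hs hxs⟩
    · intro x hx
      obtain ⟨s, hs, hxs⟩ := mem_space_iff.1 hx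
      by_cases hse : s = e
      · rw [hse, hseg, ← segment_union_segment_of_mem hpab] at hxs
        rcases hxs with hxs | hxs
        · exact mem_space_iff.2 ⟨{a, p}, Or.inr (by simp), by simpa [convexHull_pair] using hxs⟩
        · exact mem_space_iff.2 ⟨{b, p}, Or.inr (by simp), by simpa [convexHull_pair] using hxs⟩
      · exact mem_space_iff.2 ⟨s, Or.inl ⟨hs, hse⟩, hxs⟩
  · rintro s (hs | hs)
    · exact ⟨s, hs.1, Subset.rfl⟩
    · exact ⟨e, he, hsub s hs⟩
  · ext x
    have hne : ∀ q, q ≠ p → ({x} : Finset E) ≠ {q, p} := by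
      intro q hq h
      have hcard := congrArg Finset.card h
      rw [Finset.card_singleton, Finset.card_pair hq] at hcard
      omega
    constructor
    · rintro (⟨h, -⟩ | h | h | h)
      · exact Or.inr h
      · exact Or.inl (Finset.singleton_injective h)
      · exact absurd h (hne a hpa.symm)
      · exact absurd h (hne b hpb.symm)
    · rintro (rfl | h)
      · exact Or.inr (Or.inl rfl)
      · refine Or.inl ⟨h, ?_⟩
        rintro rfl
        exact hab ((Finset.mem_singleton.1 (hmem.2 (Or.inl rfl))).trans
          (Finset.mem_singleton.1 (hmem.2 (Or.inr rfl))).symm)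

theorem exists_subdivision_union (hK : K.IsFiniteGraph) {V : Set E} (hV : V.Finite)
    (hVK : V ⊆ K.space) : ∃ K' : SimplicialComplex ℝ E, K'.IsFiniteGraph ∧
      K'.IsSubdivisionOf K ∧ K'.vertices = V ∪ K.vertices := by
  induction V, hV using Set.Finite.induction_on with
  | empty => exact ⟨K, hK, .refl K, (empty_union _).symm⟩
  | @insert p V _ _ ih =>
    obtain ⟨K', hK', hsub, hv⟩ := ih ((subset_insert p V).trans hVK)
    obtain ⟨K'', hK'', hsub', hv'⟩ :=
      hK'.exists_subdivision_insert (hsub.space_eq ▸ hVK (mem_insert p V))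
    exact ⟨K'', hK'', hsub'.trans hsub, by rw [hv', hv, insert_union]⟩

end IsFiniteGraph

end Module

section Normed

variable {E : Type*} [NormedAddCommGroup E] [NormedSpace ℝ E] {K L : SimplicialComplex ℝ E}
  {s : Finset E}

namespace IsFiniteGraph

theorem isPreconnected_diff_vertices (hK : K.IsFiniteGraph) (hs : s ∈ K.faces) :
    IsPreconnected (convexHull ℝ (s : Set E) \ K.vertices) := by
  obtain ⟨a, ha, rfl⟩ | ⟨a, b, -, -, -, -, -, h⟩ := hK.eq_singleton_or_eq_pair hs
  · refine (Set.Subsingleton.anti (subsingleton_singleton (a := a)) ?_).isPreconnected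
    exact sdiff_subset.trans_eq (by simp)
  · rw [h]
    exact (convex_openSegment a b).isPreconnected

theorem closure_diff_vertices (hK : K.IsFiniteGraph) (hs : s ∈ K.faces)
    (hne : (convexHull ℝ (s : Set E) \ K.vertices).Nonempty) :
    closure (convexHull ℝ (s : Set E) \ K.vertices) = convexHull ℝ (s : Set E) := by
  obtain ⟨a, ha, rfl⟩ | ⟨a, b, -, -, -, -, hseg, h⟩ := hK.eq_singleton_or_eq_pair hs
  · obtain ⟨x, hx, hxv⟩ := hne
    simp only [Finset.coe_singleton, convexHull_singleton, mem_singleton_iff] at hx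
    exact absurd (hx ▸ ha) hxv
  · rw [h, hseg, closure_openSegment]

/-- A connected subset of a graph avoiding the vertices lies in a single edge. -/
theorem exists_subset_convexHull_of_isPreconnected (hK : K.IsFiniteGraph) {S : Set E}
    (hS : IsPreconnected S) (hne : S.Nonempty) (hSK : S ⊆ K.space)
    (hSv : Disjoint S K.vertices) :
    ∃ s ∈ K.faces, S ⊆ convexHull ℝ (s : Set E) := by
  obtain ⟨x, hx⟩ := hne
  obtain ⟨s, hs, hxs⟩ := mem_space_iff.1 (hSK hx)
  refine ⟨s, hs, ?_⟩
  have hclosed : ∀ t : Finset E, IsClosed (convexHull ℝ (t : Set E)) := fun t =>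
    (t.finite_toSet.isCompact_convexHull (𝕜 := ℝ)).isClosed
  set T := ⋃ t ∈ K.faces \ {s}, convexHull ℝ (t : Set E) with hT
  have hTc : IsClosed T := (hK.finite.subset sdiff_subset).isClosed_biUnion fun t _ => hclosed t
  have hcover : S ⊆ convexHull ℝ (s : Set E) ∪ T := by
    intro y hy
    obtain ⟨t, ht, hyt⟩ := mem_space_iff.1 (hSK hy)
    by_cases hts : t = s
    · exact Or.inl (hts ▸ hyt)
    · exact Or.inr (mem_biUnion (show t ∈ K.faces \ {s} from ⟨ht, hts⟩) hyt)
  have hinter : ∀ y ∈ S, y ∈ convexHull ℝ (s : Set E) → y ∉ T := by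
    intro y hy hys hyT
    obtain ⟨t, ⟨ht, hts⟩, hyt⟩ := mem_iUnion₂.1 hyT
    exact hts (hK.eq_of_notMem_vertices ht hs hyt hys (disjoint_left.1 hSv hy))
  rcases isPreconnected_iff_subset_of_disjoint_closed.1 hS _ _ (hclosed s) hTc hcover
    (eq_empty_of_forall_notMem fun y hy => hinter y hy.1 hy.2.1 hy.2.2) with h | h
  · exact h
  · exact absurd (h hx) (hinter x hx hxs)

/-- A homeomorphism between graphs which matches vertices matches faces. -/
theorem exists_image_convexHull_eq (hK : K.IsFiniteGraph) (hL : L.IsFiniteGraph) (f : E ≃ₜ E)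
    (hf : f '' K.space = L.space) (hfv : f '' K.vertices = L.vertices) (hs : s ∈ K.faces) :
    ∃ t ∈ L.faces, f '' convexHull ℝ (s : Set E) = convexHull ℝ (t : Set E) := by
  rcases (convexHull ℝ (s : Set E) \ K.vertices).eq_empty_or_nonempty with hemp | hne
  · obtain ⟨a, ha, rfl⟩ | ⟨a, b, -, -, -, -, -, h⟩ := hK.eq_singleton_or_eq_pair hs
    · exact ⟨{f a}, mem_vertices.1 (hfv ▸ mem_image_of_mem f ha), by simp⟩
    · rw [h] at hemp
      exact absurd hemp (nonempty_of_mem (midpoint_mem_openSegment a b)).ne_empty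
  have hdisj : ∀ S, Disjoint (f '' (S \ K.vertices)) L.vertices := fun S => by
    rw [← hfv, disjoint_image_iff f.injective]
    exact disjoint_sdiff_left
  have hsK := convexHull_subset_space hs
  obtain ⟨t, ht, hst⟩ := hL.exists_subset_convexHull_of_isPreconnected
    ((hK.isPreconnected_diff_vertices hs).image f f.continuous.continuousOn) (hne.image f)
    (hf ▸ image_mono (sdiff_subset.trans hsK)) (hdisj _)
  have hst' : f '' (convexHull ℝ (s : Set E) \ K.vertices) ⊆
      convexHull ℝ (t : Set E) \ L.vertices :=
    subset_sdiff.2 ⟨hst, hdisj _⟩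
  have hfs : f.symm '' L.space = K.space := by rw [← hf, f.image_symm, f.injective.preimage_image]
  have hfsv : f.symm '' L.vertices = K.vertices := by rw [← hfv, f.image_symm, f.injective.preimage_image]
  obtain ⟨s', hs', hts'⟩ := hK.exists_subset_convexHull_of_isPreconnected
    ((hL.isPreconnected_diff_vertices ht).image f.symm f.symm.continuous.continuousOn)
    (((hne.image f).mono hst').image f.symm)
    (hfs ▸ image_mono (sdiff_subset.trans (convexHull_subset_space ht)))
    (by
      rw [← hfsv, disjoint_image_iff f.symm.injective]
      exact disjoint_sdiff_left)
  have hss' : s = s' := by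
    obtain ⟨x, hx⟩ := hne
    refine hK.eq_of_notMem_vertices hs hs' hx.1 (hts' ⟨f x, hst' ⟨x, hx, rfl⟩, ?_⟩) hx.2
    exact f.symm_apply_apply x
  subst hss'
  have heq : f '' (convexHull ℝ (s : Set E) \ K.vertices) =
      convexHull ℝ (t : Set E) \ L.vertices := by
    refine hst'.antisymm fun y hy => ⟨f.symm y, ⟨hts' ⟨y, hy, rfl⟩, fun hv => hy.2 ?_⟩,
      f.apply_symm_apply y⟩
    rw [← hfv]
    exact ⟨_, hv, f.apply_symm_apply y⟩
  refine ⟨t, ht, ?_⟩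
  rw [← hK.closure_diff_vertices hs hne, f.image_closure, heq,
    hL.closure_diff_vertices ht (heq ▸ hne.image f)]

end IsFiniteGraph
end Normed
end Geometry.SimplicialComplex

theorem exists_homeomorph_of_strictMono {k : ℝ → ℝ} (hk : StrictMono k) (hc : Continuous k)
    {M : ℝ} (hM : ∀ r, |k r - r| ≤ M) : ∃ e : ℝ ≃ₜ ℝ, StrictMono e ∧ ∀ r, e r = k r := by
  have hsurj : Function.Surjective k := by
    refine hc.surjective ?_ ?_
    · refine Filter.tendsto_atTop_mono (f := fun r => r + -M) (fun r => ?_)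
        (Filter.tendsto_atTop_add_const_right _ _ Filter.tendsto_id)
      linarith [neg_le_of_abs_le (hM r)]
    · refine Filter.tendsto_atBot_mono (f := fun r => r + M) (fun r => ?_)
        (Filter.tendsto_atBot_add_const_right _ _ Filter.tendsto_id)
      linarith [le_of_abs_le (hM r)]
  exact ⟨(hk.orderIsoOfSurjective k hsurj).toHomeomorph, hk, fun r => rfl⟩

/-- Straight-line interpolation between the identity and an increasing homeomorphism of `ℝ`
consists of homeomorphisms. -/
theorem exists_homeomorph_interpolation {h : ℝ → ℝ} (hmono : StrictMono h) (hc : Continuous h)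
    {M : ℝ} (hM : ∀ r, |h r - r| ≤ M) {τ : ℝ} (hτ : τ ∈ Icc (0 : ℝ) 1) :
    ∃ e : ℝ ≃ₜ ℝ, StrictMono e ∧ ∀ r, e r = r + τ * (h r - r) := by
  refine exists_homeomorph_of_strictMono (M := M) (fun r r' hr => ?_) (by fun_prop) fun r => ?_
  · have h1 := hmono hr
    rcases hτ.1.eq_or_lt with rfl | hτ0
    · simpa using hr
    · nlinarith [mul_pos hτ0 (sub_pos.2 h1), mul_nonneg (sub_nonneg.2 hτ.2) (sub_pos.2 hr).le]
  · rw [add_sub_cancel_left, abs_mul, abs_of_nonneg hτ.1]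
    exact (mul_le_of_le_one_left (abs_nonneg _) hτ.2).trans (hM r)

theorem continuous_max_mul_comp_div {m : ℝ → ℝ} (hm : Continuous m) {M : ℝ}
    (hM : ∀ r, |m r| ≤ M) : Continuous fun p : ℝ × ℝ => max p.1 0 * m (p.2 / p.1) := by
  rw [continuous_iff_continuousAt]
  rintro ⟨w, z⟩
  rcases lt_or_ge 0 w with hw | hw
  · have h1 : ContinuousAt (fun p : ℝ × ℝ => p.2 / p.1) (w, z) :=
      continuousAt_snd.div continuousAt_fst hw.ne'
    have h2 : ContinuousAt (fun p : ℝ × ℝ => max p.1 0) (w, z) := by fun_prop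
    exact h2.mul (hm.continuousAt.comp' h1)
  · have hzero : max w 0 * m (z / w) = 0 := by rw [max_eq_right hw, zero_mul]
    rw [ContinuousAt, hzero]
    refine squeeze_zero_norm (a := fun p : ℝ × ℝ => max p.1 0 * M) (fun p => ?_) ?_
    · rw [norm_mul, Real.norm_of_nonneg (le_max_right _ _)]
      exact mul_le_mul_of_nonneg_left (hM _) (le_max_right _ _)
    · have : Continuous fun p : ℝ × ℝ => max p.1 0 * M := by fun_prop
      simpa [max_eq_right hw] using this.tendsto (w, z)

section Slide

variable {E : Type*} [NormedAddCommGroup E] [NormedSpace ℝ E]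

/-- Push `x` in the direction `u` by the displacement `m`, rescaled from the interval `[0, 1]` to
the interval `[δ x, 1 - δ x]` of values of the coordinate `s`. -/
noncomputable def slide (s δ : E → ℝ) (u : E) (m : ℝ → ℝ) (x : E) : E :=
  x + (max (1 - 2 * δ x) 0 * m ((s x - δ x) / (1 - 2 * δ x))) • u

variable {s δ : E → ℝ} {u : E}

theorem slide_slide (hs : ∀ x (r : ℝ), s (x + r • u) = s x + r)
    (hδ : ∀ x (r : ℝ), δ (x + r • u) = δ x)
    {m n : ℝ → ℝ} (hmn : ∀ r, m r + n (r + m r) = 0) (x : E) :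
    slide s δ u n (slide s δ u m x) = x := by
  rcases lt_or_ge 0 (1 - 2 * δ x) with hw | hw
  · simp only [slide, hs, hδ, max_eq_left hw.le]
    set w := 1 - 2 * δ x
    set q := (s x - δ x) / w with hq
    have : (s x + w * m q - δ x) / w = q + m q := by
      rw [hq]
      field_simp
      ring
    rw [this, add_assoc, ← add_smul, ← mul_add, hmn, mul_zero, zero_smul, add_zero]
  · simp [slide, max_eq_right hw]

theorem slide_eq_self {m : ℝ → ℝ} (hm : ∀ r, r ∉ Ioo (0 : ℝ) 1 → m r = 0) {x : E}
    (hx : s x ≤ δ x ∨ 1 - s x ≤ δ x) : slide s δ u m x = x := by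
  rcases lt_or_ge 0 (1 - 2 * δ x) with hw | hw
  · rw [slide, hm, mul_zero, zero_smul, add_zero]
    rintro ⟨h0, h1⟩
    rw [lt_div_iff₀ hw] at h0
    rw [div_lt_one hw] at h1
    rcases hx with hx | hx <;> linarith
  · simp [slide, max_eq_right hw]

theorem slide_eq_of_eq_zero {x : E} (hx : δ x = 0) (m : ℝ → ℝ) :
    slide s δ u m x = x + m (s x) • u := by
  simp [slide, hx]

theorem continuous_slide (hs : Continuous s) (hδ : Continuous δ) {m : ℝ → ℝ} (hm : Continuous m)
    {M : ℝ} (hM : ∀ r, |m r| ≤ M) : Continuous (slide s δ u m) := by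
  have h : Continuous fun x => ((1 - 2 * δ x, s x - δ x) : ℝ × ℝ) := by fun_prop
  exact continuous_id.add (((continuous_max_mul_comp_div hm hM).comp h).smul continuous_const)

/-- An increasing homeomorphism `h` of `ℝ` supported in `[0, 1]` extends to an isotopy sliding
along a line, supported in a double cone around the unit interval of the line. -/
theorem exists_isotopy_slide (hs : Continuous s) (hδ : Continuous δ)
    (hsu : ∀ x (r : ℝ), s (x + r • u) = s x + r) (hδu : ∀ x (r : ℝ), δ (x + r • u) = δ x)
    {h : ℝ → ℝ} (hmono : StrictMono h) (hc : Continuous h)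
    (hsupp : ∀ r, r ∉ Ioo (0 : ℝ) 1 → h r = r) :
    ∃ D : ℝ → E ≃ₜ E, Continuous (fun p : ℝ × E => D p.1 p.2) ∧ D 0 = Homeomorph.refl E ∧
      (∀ t x, s x ≤ δ x ∨ 1 - s x ≤ δ x → D t x = x) ∧
      (∀ t, D t '' {x | δ x = 0 ∧ s x ∈ Icc (0 : ℝ) 1} = {x | δ x = 0 ∧ s x ∈ Icc (0 : ℝ) 1}) ∧
      (∀ x, δ x = 0 → D 1 x = x + (h (s x) - s x) • u) := by
  have hbound : ∀ r, |h r - r| ≤ 1 := by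
    intro r
    by_cases hr : r ∈ Ioo (0 : ℝ) 1
    · have h0 := hmono hr.1
      have h1 := hmono hr.2
      rw [hsupp 0 (by simp)] at h0
      rw [hsupp 1 (by simp)] at h1
      rw [abs_le]
      constructor <;> linarith [hr.1, hr.2]
    · simp [hsupp r hr]
  let τ : ℝ → ℝ := fun t => max 0 (min 1 t)
  have hτ : ∀ t, τ t ∈ Icc (0 : ℝ) 1 := fun t =>
    ⟨le_max_left _ _, max_le zero_le_one (min_le_left _ _)⟩
  choose e hemono he using fun t => exists_homeomorph_interpolation hmono hc hbound (hτ t)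
  have hbound' : ∀ t r, |τ t * (h r - r)| ≤ 1 := fun t r => by
    rw [abs_mul, abs_of_nonneg (hτ t).1]
    exact (mul_le_of_le_one_left (abs_nonneg _) (hτ t).2).trans (hbound r)
  have hm : ∀ t r, (e t r - r) = τ t * (h r - r) := fun t r => by rw [he]; ring
  have hMe : ∀ t r, |e t r - r| ≤ 1 := fun t r => hm t r ▸ hbound' t r
  have hMs : ∀ t r, |(e t).symm r - r| ≤ 1 := fun t r => by
    have := hMe t ((e t).symm r)
    rwa [(e t).apply_symm_apply, abs_sub_comm] at this
  have hes : ∀ t r, r ∉ Ioo (0 : ℝ) 1 → e t r - r = 0 := fun t r hr => by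
    rw [hm, hsupp r hr, sub_self, mul_zero]
  let D : ℝ → E ≃ₜ E := fun t =>
    { toFun := slide s δ u fun r => e t r - r
      invFun := slide s δ u fun r => (e t).symm r - r
      left_inv := fun x => slide_slide hsu hδu (fun r => by simp) x
      right_inv := fun x => slide_slide hsu hδu (fun r => by simp) x
      continuous_toFun := continuous_slide hs hδ (by fun_prop) (hMe t)
      continuous_invFun := continuous_slide hs hδ (by fun_prop) (hMs t) }
  have hD : ∀ t x, D t x = slide s δ u (fun r => e t r - r) x := fun t x => rfl
  have hDs : ∀ t x, (D t).symm x = slide s δ u (fun r => (e t).symm r - r) x := fun t x => rfl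
  have he0 : ∀ t, e t 0 = 0 := fun t => by simpa using hes t 0 (by simp)
  have he1 : ∀ t, e t 1 = 1 := fun t => by simpa [sub_eq_zero] using hes t 1 (by simp)
  refine ⟨D, ?_, ?_, fun t x hx => slide_eq_self (hes t) hx, fun t => ?_, fun x hx => ?_⟩
  · have hDt : (fun p : ℝ × E => D p.1 p.2) = fun p : ℝ × E =>
        p.2 + (τ p.1 * (max (1 - 2 * δ p.2) 0 *
          (h ((s p.2 - δ p.2) / (1 - 2 * δ p.2)) - (s p.2 - δ p.2) / (1 - 2 * δ p.2)))) • u := by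
      funext p
      rw [hD, slide, hm, mul_left_comm]
    have hpair : Continuous fun p : ℝ × E => ((1 - 2 * δ p.2, s p.2 - δ p.2) : ℝ × ℝ) := by
      fun_prop
    have hmc : Continuous fun r => h r - r := by fun_prop
    have hτc : Continuous fun p : ℝ × E => τ p.1 := by fun_prop
    rw [hDt]
    exact continuous_snd.add ((hτc.mul
      ((continuous_max_mul_comp_div hmc hbound).comp hpair)).smul continuous_const)
  · ext x
    have : ∀ r, e 0 r - r = 0 := fun r => by rw [hm]; simp [τ]
    simp [hD, slide, this]
  · refine Subset.antisymm (image_subset_iff.2 fun x hx => ?_) fun x hx =>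
      ⟨(D t).symm x, ?_, (D t).apply_symm_apply x⟩
    · rw [mem_preimage, hD, slide_eq_of_eq_zero hx.1, mem_ofPred_eq, hδu, hsu, add_sub_cancel]
      refine ⟨hx.1, ?_, ?_⟩
      · simpa only [he0] using (hemono t).monotone hx.2.1
      · simpa only [he1] using (hemono t).monotone hx.2.2
    · rw [hDs, slide_eq_of_eq_zero hx.1, mem_ofPred_eq, hδu, hsu, add_sub_cancel]
      refine ⟨hx.1, ?_, ?_⟩
      · rw [← (hemono t).le_iff_le, he0, (e t).apply_symm_apply]
        exact hx.2.1
      · rw [← (hemono t).le_iff_le, he1, (e t).apply_symm_apply]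
        exact hx.2.2
  · rw [hD, slide_eq_of_eq_zero hx, hm]
    simp [τ]

end Slide

section Edge

variable {E : Type*} [NormedAddCommGroup E] [NormedSpace ℝ E]

theorem exists_le_mul_norm_sub_smul (ℓ : E →L[ℝ] ℝ) (u v : E)
    (hv : v - ℓ v • u = 0 → ℓ v ≤ 0) :
    ∃ N : ℝ, ∀ r : ℝ, 0 ≤ r → ℓ (r • v) ≤ N * ‖r • v - ℓ (r • v) • u‖ := by
  by_cases h : v - ℓ v • u = 0
  · refine ⟨0, fun r hr => ?_⟩
    rw [zero_mul, map_smul, smul_eq_mul]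
    exact mul_nonpos_of_nonneg_of_nonpos hr (hv h)
  · refine ⟨ℓ v / ‖v - ℓ v • u‖, fun r hr => ?_⟩
    have h1 : r • v - ℓ (r • v) • u = r • (v - ℓ v • u) := by
      rw [map_smul, smul_sub, smul_assoc]
    rw [h1, norm_smul, Real.norm_of_nonneg hr, map_smul, smul_eq_mul]
    have := norm_ne_zero_iff.2 h
    exact le_of_eq (by field_simp)

theorem mem_segment_iff_of_apply_sub_eq_one {c d x : E} {ℓ : E →L[ℝ] ℝ} (hℓ : ℓ (d - c) = 1) :
    x ∈ segment ℝ c d ↔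
      x - c - ℓ (x - c) • (d - c) = 0 ∧ ℓ (x - c) ∈ Icc (0 : ℝ) 1 := by
  rw [segment_eq_image']
  constructor
  · rintro ⟨r, hr, rfl⟩
    simp only [add_sub_cancel_left, map_smul, hℓ, smul_eq_mul, mul_one, sub_self, true_and]
    exact hr
  · rintro ⟨h, hr⟩
    refine ⟨_, hr, ?_⟩
    dsimp only
    rw [← sub_eq_zero.1 h, add_sub_cancel]

open Geometry SimplicialComplex

variable {K L : SimplicialComplex ℝ E} {s t : Finset E} {c d : E}

namespace Geometry.SimplicialComplex.IsFiniteGraph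

theorem exists_cone_bound_of_mem (hK : K.IsFiniteGraph) (hs : s ∈ K.faces)
    (hscd : (s : Set E) = {c, d}) {ℓ : E →L[ℝ] ℝ} (hℓ : ℓ (d - c) = 1) (ht : t ∈ K.faces)
    (hts : t ≠ s) (hct : c ∈ t) :
    ∃ N : ℝ, ∀ x ∈ convexHull ℝ (t : Set E),
      ℓ (x - c) ≤ N * ‖x - c - ℓ (x - c) • (d - c)‖ := by
  have hseg : ∃ e, convexHull ℝ (t : Set E) = segment ℝ c e := by
    obtain ⟨a, -, rfl⟩ | ⟨a, b, -, -, -, htab, htseg, -⟩ := hK.eq_singleton_or_eq_pair ht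
    · exact ⟨c, by simp [Finset.mem_singleton.1 hct]⟩
    · rw [← Finset.mem_coe, htab] at hct
      rcases hct with rfl | rfl
      · exact ⟨b, htseg⟩
      · exact ⟨a, by rw [htseg, segment_symm]⟩
  obtain ⟨e, he⟩ := hseg
  obtain ⟨N, hN⟩ := exists_le_mul_norm_sub_smul ℓ (d - c) (e - c) (by
    intro h
    by_contra! hpos
    have hr : 0 < min (1 / 2) (ℓ (e - c)) := lt_min (by norm_num) hpos
    have hr1 : min (1 / 2) (ℓ (e - c)) < 1 := (min_le_left _ _).trans_lt (by norm_num)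
    have hr2 := min_le_right (1 / 2) (ℓ (e - c))
    set r := min (1 / 2) (ℓ (e - c))
    have hxs : c + r • (d - c) ∈ convexHull ℝ (s : Set E) := by
      rw [hscd, convexHull_pair, segment_eq_image']
      exact ⟨r, ⟨hr.le, hr1.le⟩, rfl⟩
    have hxt : c + r • (d - c) ∈ convexHull ℝ (t : Set E) := by
      rw [he, segment_eq_image']
      refine ⟨r / ℓ (e - c), ⟨by positivity, (div_le_one hpos).2 hr2⟩, ?_⟩
      change c + (r / ℓ (e - c)) • (e - c) = _
      nth_rewrite 2 [sub_eq_zero.1 h]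
      rw [smul_smul, div_mul_cancel₀ _ hpos.ne']
    have hmem := (hK.mem_of_ne hs ht hts.symm hxs hxt).1
    rw [← Finset.mem_coe, hscd] at hmem
    rcases hmem with h1 | h1
    · have h2 := congrArg (fun y => ℓ (y - c)) h1
      simp [hℓ] at h2
      exact hr.ne' h2
    · have h2 := congrArg (fun y => ℓ (y - c)) h1
      simp only [add_sub_cancel_left, map_smul, hℓ, smul_eq_mul, mul_one] at h2
      exact hr1.ne h2)
  refine ⟨N, fun x hx => ?_⟩
  rw [he, segment_eq_image'] at hx
  obtain ⟨r, hr, rfl⟩ := hx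
  simpa only [add_sub_cancel_left] using hN r hr.1

/-- All faces other than the edge `{c, d}` stay outside a double cone around that edge. -/
theorem exists_cone_bound (hK : K.IsFiniteGraph) (hs : s ∈ K.faces)
    (hscd : (s : Set E) = {c, d}) {ℓ : E →L[ℝ] ℝ} (hℓ : ℓ (d - c) = 1) :
    ∃ N : ℝ, 0 < N ∧ ∀ t ∈ K.faces, t ≠ s → ∀ x ∈ convexHull ℝ (t : Set E),
      ℓ (x - c) ≤ N * ‖x - c - ℓ (x - c) • (d - c)‖ ∨
      1 - ℓ (x - c) ≤ N * ‖x - c - ℓ (x - c) • (d - c)‖ := by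
  have hface : ∀ t : Finset E, ∃ N : ℝ, t ∈ K.faces → t ≠ s → ∀ x ∈ convexHull ℝ (t : Set E),
      ℓ (x - c) ≤ N * ‖x - c - ℓ (x - c) • (d - c)‖ ∨
      1 - ℓ (x - c) ≤ N * ‖x - c - ℓ (x - c) • (d - c)‖ := by
    intro t
    by_cases ht : t ∈ K.faces ∧ t ≠ s
    swap
    · exact ⟨0, fun h1 h2 => absurd ⟨h1, h2⟩ ht⟩
    obtain ⟨ht, hts⟩ := ht
    by_cases hct : c ∈ t
    · obtain ⟨N, hN⟩ := hK.exists_cone_bound_of_mem hs hscd hℓ ht hts hct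
      exact ⟨N, fun _ _ x hx => Or.inl (hN x hx)⟩
    by_cases hdt : d ∈ t
    · obtain ⟨N, hN⟩ := hK.exists_cone_bound_of_mem (ℓ := -ℓ) hs
        (hscd.trans (pair_comm c d)) (by simpa using hℓ) ht hts hdt
      refine ⟨N, fun _ _ x hx => Or.inr ?_⟩
      have h1 : (-ℓ) (x - d) = 1 - ℓ (x - c) := by
        have : x - d = (x - c) - (d - c) := by abel
        rw [neg_apply, this, map_sub, hℓ]
        ring
      have h2 := hN x hx
      rw [h1] at h2
      have h3 : x - d - (1 - ℓ (x - c)) • (c - d) = x - c - ℓ (x - c) • (d - c) := by module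
      rwa [h3] at h2
    · have hcomp : IsCompact (convexHull ℝ (t : Set E) ∩ {x | ℓ (x - c) ∈ Icc (0 : ℝ) 1}) :=
        (t.finite_toSet.isCompact_convexHull (𝕜 := ℝ)).inter_right
          (isClosed_Icc.preimage (by fun_prop : Continuous fun x => ℓ (x - c)))
      obtain ⟨ε, hε, hle⟩ := hcomp.exists_forall_le' (a := 0)
        (f := fun x => ‖x - c - ℓ (x - c) • (d - c)‖) (by fun_prop) (by
          rintro x ⟨hxt, hx⟩
          refine norm_pos_iff.2 fun h => ?_
          have hxs : x ∈ convexHull ℝ (s : Set E) := by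
            rw [hscd, convexHull_pair]
            exact (mem_segment_iff_of_apply_sub_eq_one hℓ).2 ⟨h, hx⟩
          obtain ⟨h1, h2⟩ := hK.mem_of_ne hs ht hts.symm hxs hxt
          rw [← Finset.mem_coe, hscd] at h1
          rcases h1 with rfl | rfl
          · exact hct h2
          · exact hdt h2)
      refine ⟨1 / ε, fun _ _ x hx => ?_⟩
      have hpos : 0 ≤ 1 / ε * ‖x - c - ℓ (x - c) • (d - c)‖ := by positivity
      by_cases hx0 : ℓ (x - c) < 0
      · exact Or.inl (hx0.le.trans hpos)
      by_cases hx1 : 1 < ℓ (x - c)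
      · exact Or.inr (le_trans (by linarith) hpos)
      push Not at hx0 hx1
      left
      refine hx1.trans ?_
      rw [one_div_mul_eq_div, one_le_div hε]
      exact hle x ⟨hx, hx0, hx1⟩
  choose N hN using hface
  obtain ⟨M, hM⟩ := (hK.finite.image N).bddAbove
  refine ⟨max M 1, by positivity, fun t ht hts x hx => ?_⟩
  have hmono : N t * ‖x - c - ℓ (x - c) • (d - c)‖ ≤
      max M 1 * ‖x - c - ℓ (x - c) • (d - c)‖ :=
    mul_le_mul_of_nonneg_right ((hM (mem_image_of_mem N ht)).trans (le_max_left _ _))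
      (norm_nonneg _)
  exact (hN t ht hts x hx).imp (fun h => h.trans hmono) fun h => h.trans hmono

end Geometry.SimplicialComplex.IsFiniteGraph

/-- An increasing injection of `[0, 1]` fixing the endpoints, extended by the identity. -/
theorem exists_homeomorph_extending {φ : ℝ → ℝ} (hc : Continuous φ)
    (hinj : InjOn φ (Icc 0 1)) (h0 : φ 0 = 0) (h1 : φ 1 = 1) :
    ∃ e : ℝ ≃ₜ ℝ, StrictMono e ∧ (∀ r ∈ Icc (0 : ℝ) 1, e r = φ r) ∧
      ∀ r, r ∉ Ioo (0 : ℝ) 1 → e r = r := by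
  have hφ : StrictMonoOn φ (Icc 0 1) :=
    hc.continuousOn.strictMonoOn_of_injOn_Icc zero_le_one (by rw [h0, h1]; exact zero_le_one) hinj
  let p : ℝ → ℝ := fun r => max 0 (min 1 r)
  have hp : ∀ r, p r ∈ Icc (0 : ℝ) 1 := fun r =>
    ⟨le_max_left _ _, max_le zero_le_one (min_le_left _ _)⟩
  have hpid : ∀ r ∈ Icc (0 : ℝ) 1, p r = r := fun r hr => by simp [p, hr.1, hr.2]
  have hpmono : Monotone p := fun r r' h => by dsimp only [p]; gcongr
  have hpsub : Monotone fun r => r - p r := fun r r' h => by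
    dsimp only [p]
    rcases max_cases 0 (min 1 r) with h1 | h1 <;> rcases max_cases 0 (min 1 r') with h2 | h2 <;>
      rcases min_cases 1 r with h3 | h3 <;> rcases min_cases 1 r' with h4 | h4 <;> linarith
  obtain ⟨e, hemono, he⟩ := exists_homeomorph_of_strictMono (k := fun r => φ (p r) + (r - p r))
    (M := 1) (by
      intro r r' h
      rcases (hpmono h.le).eq_or_lt with heq | hlt
      · simp only [heq]
        linarith
      · exact add_lt_add_of_lt_of_le (hφ (hp r) (hp r') hlt) (hpsub h.le))
    (by fun_prop) (by
      intro r
      have ha := hφ.monotoneOn (left_mem_Icc.2 zero_le_one) (hp r) (hp r).1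
      have hb := hφ.monotoneOn (hp r) (right_mem_Icc.2 zero_le_one) (hp r).2
      rw [h0] at ha
      rw [h1] at hb
      rw [abs_le]
      constructor <;> linarith [(hp r).1, (hp r).2])
  refine ⟨e, hemono, fun r hr => by rw [he, hpid r hr]; ring, fun r hr => ?_⟩
  rw [he]
  rcases le_or_gt r 0 with h | h
  · have : p r = 0 := by simp [p, h]
    rw [this, h0]
    ring
  · have : p r = 1 := by
      have : 1 ≤ r := by by_contra! h'; exact hr ⟨h, h'⟩
      simp [p, this]
    rw [this, h1]
    ring

namespace Geometry.SimplicialComplex.IsFiniteGraph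

/-- A homeomorphism carrying a segment onto an edge of a graph can be made affine on the segment
by an ambient isotopy which preserves the edge and fixes all other faces. -/
theorem exists_isotopy_affine_on_segment (hL : L.IsFiniteGraph) (hs : s ∈ L.faces) (hcd : c ≠ d)
    (hscd : (s : Set E) = {c, d}) (f : E ≃ₜ E) {a b : E} (hab : a ≠ b) (ha : f a = c)
    (hb : f b = d) (hf : f '' segment ℝ a b = segment ℝ c d) :
    ∃ D : ℝ → E ≃ₜ E, Continuous (fun p : ℝ × E => D p.1 p.2) ∧ D 0 = Homeomorph.refl E ∧
      (∀ t, ∀ u ∈ L.faces, u ≠ s → EqOn (D t) id (convexHull ℝ (u : Set E))) ∧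
      (∀ t, D t '' convexHull ℝ (s : Set E) = convexHull ℝ (s : Set E)) ∧
      ∃ A : E →ᵃ[ℝ] E, EqOn (D 1 ∘ f) A (segment ℝ a b) := by
  obtain ⟨ℓ, hℓ⟩ := SeparatingDual.exists_eq_one (R := ℝ) (sub_ne_zero.2 hcd.symm)
  obtain ⟨ℓ', hℓ'⟩ := SeparatingDual.exists_eq_one (R := ℝ) (sub_ne_zero.2 hab.symm)
  obtain ⟨N, hN, hcone⟩ := hL.exists_cone_bound hs hscd hℓ
  have hfseg : ∀ r ∈ Icc (0 : ℝ) 1, f (a + r • (b - a)) ∈ segment ℝ c d := fun r hr => by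
    rw [← hf, segment_eq_image' ℝ a b]
    exact ⟨_, ⟨r, hr, rfl⟩, rfl⟩
  have hinj : InjOn (fun r : ℝ => ℓ (f (a + r • (b - a)) - c)) (Icc 0 1) := by
    intro r hr r' hr' h
    have h1 := ((mem_segment_iff_of_apply_sub_eq_one hℓ).1 (hfseg r hr)).1
    have h2 := ((mem_segment_iff_of_apply_sub_eq_one hℓ).1 (hfseg r' hr')).1
    dsimp only at h
    rw [sub_eq_zero] at h1 h2
    rw [h, ← h2, sub_left_inj, f.injective.eq_iff, add_right_inj] at h1
    exact smul_left_injective ℝ (sub_ne_zero.2 hab.symm) h1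
  obtain ⟨e, hemono, heφ, hesupp⟩ := exists_homeomorph_extending (by fun_prop) hinj
    (by simp [ha]) (by simp [hb, hℓ])
  set u := d - c with hu
  have hproj : ∀ (x : E) (r : ℝ), ℓ (x + r • u - c) = ℓ (x - c) + r := fun x r => by
    rw [add_sub_right_comm, map_add, map_smul, hℓ, smul_eq_mul, mul_one]
  obtain ⟨D, hDc, hD0, hDfix, hDimg, hD1⟩ := exists_isotopy_slide (u := u)
    (s := fun x => ℓ (x - c)) (δ := fun x => N * ‖x - c - ℓ (x - c) • u‖) (by fun_prop)
    (by fun_prop) hproj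
    (fun x r => by
      rw [hproj, add_sub_right_comm, add_smul, add_sub_add_right_eq_sub])
    (h := e.symm)
    (fun r r' h => by rwa [← hemono.lt_iff_lt, e.apply_symm_apply, e.apply_symm_apply])
    e.symm.continuous (fun r hr => by rw [e.symm_apply_eq, hesupp r hr])
  have hzero : ∀ x, N * ‖x - c - ℓ (x - c) • u‖ = 0 ↔ x - c - ℓ (x - c) • u = 0 := fun x => by
    rw [mul_eq_zero, or_iff_right hN.ne', norm_eq_zero]
  have hsseg : {x | N * ‖x - c - ℓ (x - c) • u‖ = 0 ∧ ℓ (x - c) ∈ Icc (0 : ℝ) 1} =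
      convexHull ℝ (s : Set E) := by
    ext x
    rw [hscd, convexHull_pair, mem_segment_iff_of_apply_sub_eq_one hℓ, ← hzero x]
    rfl
  rw [hsseg] at hDimg
  refine ⟨D, hDc, hD0, fun t v hv hvs x hx => hDfix t x (hcone v hv hvs x hx), hDimg,
    ((ℓ' : E →ₗ[ℝ] ℝ).smulRight u).toAffineMap + AffineMap.const ℝ E (c - ℓ' a • u), ?_⟩
  rintro x hx
  rw [segment_eq_image'] at hx
  obtain ⟨r, hr, rfl⟩ := hx
  have hx := ((mem_segment_iff_of_apply_sub_eq_one hℓ).1 (hfseg r hr)).1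
  have her := heφ r hr
  dsimp only at her ⊢
  rw [Function.comp_apply, hD1 _ ((hzero _).2 hx), ← her, e.symm_apply_apply]
  rw [← her, sub_sub, sub_eq_zero] at hx
  rw [hx]
  simp [map_add, hℓ']
  module

/-- A homeomorphism matching the faces of two graphs can be made affine over any finite set of
faces by an ambient isotopy preserving every face of the target. -/
theorem exists_isotopy_affine (hK : K.IsFiniteGraph) (hL : L.IsFiniteGraph) (f : E ≃ₜ E)
    (hf : f '' K.space = L.space) (hfv : f '' K.vertices = L.vertices) (S : Finset (Finset E)) :
    ∃ G : ℝ → E ≃ₜ E, Continuous (fun p : ℝ × E => G p.1 p.2) ∧ G 0 = Homeomorph.refl E ∧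
      ∀ s ∈ L.faces, (∀ t, G t '' convexHull ℝ (s : Set E) = convexHull ℝ (s : Set E)) ∧
        (s ∉ S → ∀ t, EqOn (G t) id (convexHull ℝ (s : Set E))) ∧
        (s ∈ S → ∃ A : E →ᵃ[ℝ] E, EqOn (G 1 ∘ f) A (f ⁻¹' convexHull ℝ (s : Set E))) := by
  classical
  induction S using Finset.induction_on with
  | empty =>
    exact ⟨fun _ => Homeomorph.refl E, continuous_snd, rfl, fun s _ =>
      ⟨fun _ => image_id _, fun _ _ _ _ => rfl, fun h => absurd h (Finset.notMem_empty s)⟩⟩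
  | insert s S hsS ih =>
    obtain ⟨G, hGc, hG0, hG⟩ := ih
    have hstep : ∃ D : ℝ → E ≃ₜ E, Continuous (fun p : ℝ × E => D p.1 p.2) ∧
        D 0 = Homeomorph.refl E ∧
        (∀ t, ∀ u ∈ L.faces, u ≠ s → EqOn (D t) id (convexHull ℝ (u : Set E))) ∧
        (∀ t, D t '' convexHull ℝ (s : Set E) = convexHull ℝ (s : Set E)) ∧
        (s ∈ L.faces → ∃ A : E →ᵃ[ℝ] E, EqOn (D 1 ∘ f) A (f ⁻¹' convexHull ℝ (s : Set E))) := by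
      by_cases hs : s ∈ L.faces
      swap
      · exact ⟨fun _ => Homeomorph.refl E, continuous_snd, rfl, fun _ _ _ _ _ _ => rfl,
          fun _ => image_id _, fun h => absurd h hs⟩
      obtain ⟨c, -, rfl⟩ | ⟨c, d, hcd, hc, hd, hscd, hseg, -⟩ := hL.eq_singleton_or_eq_pair hs
      · refine ⟨fun _ => Homeomorph.refl E, continuous_snd, rfl, fun _ _ _ _ _ _ => rfl,
          fun _ => image_id _, fun _ => ⟨AffineMap.const ℝ E c, fun x hx => ?_⟩⟩
        simpa using hx
      · have hfs : f.symm '' L.space = K.space := by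
          rw [← hf, f.image_symm, f.injective.preimage_image]
        have hfsv : f.symm '' L.vertices = K.vertices := by
          rw [← hfv, f.image_symm, f.injective.preimage_image]
        obtain ⟨s', hs', hss'⟩ := hL.exists_image_convexHull_eq hK f.symm hfs hfsv hs
        have hmem : ∀ x ∈ ({c, d} : Set E), f.symm x ∈ s' := fun x hx => by
          refine (vertex_mem_convexHull_iff (hfsv ▸ mem_image_of_mem f.symm ?_) hs').1
            (hss' ▸ mem_image_of_mem f.symm (subset_convexHull ℝ _ (hscd ▸ hx)))
          rcases hx with rfl | rfl
          exacts [hc, hd]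
        have hne : f.symm c ≠ f.symm d := f.symm.injective.ne hcd
        have hs'eq : ({f.symm c, f.symm d} : Finset E) = s' := by
          refine Finset.eq_of_subset_of_card_le ?_ ?_
          · intro x hx
            rcases Finset.mem_insert.1 hx with rfl | hx
            · exact hmem c (by simp)
            · rw [Finset.mem_singleton.1 hx]
              exact hmem d (by simp)
          · rw [Finset.card_pair hne]
            exact hK.card_le_two s' hs'
        have hpre : f ⁻¹' convexHull ℝ (s : Set E) = segment ℝ (f.symm c) (f.symm d) := by
          rw [← f.image_symm, hss', ← hs'eq, Finset.coe_pair, convexHull_pair]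
        obtain ⟨D, h1, h2, h3, h4, h5⟩ := hL.exists_isotopy_affine_on_segment hs hcd hscd f hne
          (f.apply_symm_apply c) (f.apply_symm_apply d)
          (by rw [← hpre, f.surjective.image_preimage, hseg])
        exact ⟨D, h1, h2, h3, h4, fun _ => hpre ▸ h5⟩
    obtain ⟨D, hDc, hD0, hDfix, hDimg, hDaff⟩ := hstep
    refine ⟨fun t => (G t).trans (D t), hDc.comp (continuous_fst.prodMk hGc), ?_,
      fun v hv => ⟨fun t => ?_, fun hvS t x hx => ?_, fun hvS => ?_⟩⟩
    · simp only [hG0, hD0]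
      rfl
    · change (D t ∘ G t) '' _ = _
      rw [image_comp, (hG v hv).1 t]
      by_cases hvs : v = s
      · rw [hvs, hDimg]
      · rw [(hDfix t v hv hvs).image_eq, image_id]
    · rw [Finset.mem_insert, not_or] at hvS
      rw [Homeomorph.trans_apply, (hG v hv).2.1 hvS.2 t hx]
      exact hDfix t v hv hvS.1 hx
    · by_cases hvs : v = s
      · subst hvs
        obtain ⟨A, hA⟩ := hDaff hv
        refine ⟨A, fun x hx => ?_⟩
        rw [← hA hx, Function.comp_apply, Homeomorph.trans_apply, (hG v hv).2.1 hsS 1 hx]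
        rfl
      · obtain ⟨A, hA⟩ := (hG v hv).2.2 (Finset.mem_of_mem_insert_of_ne hvS hvs)
        refine ⟨A, fun x hx => ?_⟩
        rw [← hA hx, Function.comp_apply, Homeomorph.trans_apply]
        refine hDfix 1 v hv hvs ?_
        rw [← (hG v hv).1 1]
        exact mem_image_of_mem _ hx

end Geometry.SimplicialComplex.IsFiniteGraph

end Edge

/-- Lemma 1 of the paper (a variant of Brown's lemma (4.4)): a homeomorphism of `ℝ³` carrying
one `1`-dimensional polyhedron onto another is isotopic, through homeomorphisms preserving this
correspondence of polyhedra, to a homeomorphism which is piecewise affine on the first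
polyhedron (with respect to suitable subdivisions of the two complexes). -/
theorem homeo_isotopic_to_pl_on_one_complex (K₁ L₁ : Geometry.SimplicialComplex ℝ E3)
    (hK₁fin : K₁.faces.Finite) (hL₁fin : L₁.faces.Finite)
    (hK₁dim : ∀ s ∈ K₁.faces, s.card ≤ 2) (hL₁dim : ∀ s ∈ L₁.faces, s.card ≤ 2)
    (f : Homeomorph E3 E3) (hf : f '' K₁.space = L₁.space) :
    ∃ g : ℝ → Homeomorph E3 E3,
      ContinuousOn (fun p : ℝ × E3 => g p.1 p.2) (Set.Icc 0 1 ×ˢ Set.univ) ∧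
      g 0 = f ∧
      (∀ t ∈ Set.Icc (0 : ℝ) 1, g t '' K₁.space = L₁.space) ∧
      ∃ K₁' L₁' : Geometry.SimplicialComplex ℝ E3,
        K₁'.faces.Finite ∧ L₁'.faces.Finite ∧
        (∀ s ∈ K₁'.faces, s.card ≤ 2) ∧ (∀ s ∈ L₁'.faces, s.card ≤ 2) ∧
        K₁'.space = K₁.space ∧ L₁'.space = L₁.space ∧
        (∀ s ∈ K₁'.faces, ∃ u ∈ K₁.faces,
          convexHull ℝ (s : Set E3) ⊆ convexHull ℝ (u : Set E3)) ∧
        (∀ s ∈ L₁'.faces, ∃ u ∈ L₁.faces,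
          convexHull ℝ (s : Set E3) ⊆ convexHull ℝ (u : Set E3)) ∧
        MapsFacesAffinely (g 1) K₁' L₁' := by
  obtain ⟨hK, hL⟩ : K₁.IsFiniteGraph ∧ L₁.IsFiniteGraph :=
    ⟨⟨hK₁fin, hK₁dim⟩, ⟨hL₁fin, hL₁dim⟩⟩
  obtain ⟨K, hKgraph, hKsub, hKv⟩ := hK.exists_subdivision_union
    (V := f ⁻¹' L₁.vertices) (hL.vertices_finite.preimage f.injective.injOn)
    (fun x hx => by
      have hx' := L₁.vertices_subset_space hx
      rwa [← hf, f.injective.mem_set_image] at hx')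
  obtain ⟨L, hLgraph, hLsub, hLv⟩ := hL.exists_subdivision_union
    (V := f '' K₁.vertices) (hK.vertices_finite.image f)
    (hf ▸ image_mono K₁.vertices_subset_space)
  have hfs : f '' K.space = L.space := by rw [hKsub.space_eq, hLsub.space_eq, hf]
  have hfv : f '' K.vertices = L.vertices := by
    rw [hKv, hLv, image_union, f.surjective.image_preimage, union_comm]
  obtain ⟨G, hGc, hG0, hG⟩ :=
    hKgraph.exists_isotopy_affine hLgraph f hfs hfv hLgraph.finite.toFinset
  have hGspace : ∀ t, G t '' L.space = L.space := fun t => by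
    simp only [Geometry.SimplicialComplex.space, image_iUnion]
    exact iUnion₂_congr fun s hs => (hG s hs).1 t
  refine ⟨fun t => f.trans (G t), ?_, ?_, fun t _ => ?_, K, L, hKgraph.finite, hLgraph.finite,
    hKgraph.card_le_two, hLgraph.card_le_two, hKsub.space_eq, hLsub.space_eq,
    hKsub.exists_subset, hLsub.exists_subset, fun s hs => ?_⟩
  · exact (hGc.comp (continuous_fst.prodMk (f.continuous.comp continuous_snd))).continuousOn
  · simp only [hG0]
    rfl
  · change (G t ∘ f) '' _ = _
    rw [image_comp, hf, ← hLsub.space_eq, hGspace]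
  · obtain ⟨u, hu, hsu⟩ := hKgraph.exists_image_convexHull_eq hLgraph f hfs hfv hs
    obtain ⟨A, hA⟩ := (hG u hu).2.2 (hLgraph.finite.mem_toFinset.2 hu)
    refine ⟨u, hu, ?_, A, ?_⟩
    · change (G 1 ∘ f) '' _ = _
      rw [image_comp, hsu, (hG u hu).1]
    · rw [← hsu, f.injective.preimage_image] at hA
      exact hA
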